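/- arXiv:2407.11755 — 4 statements merged into one kernel-verified Lean document; each statement's English description precedes it below -/
import Mathlib

section
/- For a 4×4 complex matrix M indexed by pairs (i,j) ∈ {0,1}×{0,1} (first index = qubit A, second = qubit B), define its partial transpose on B by (M^{T_B})_{(i,j),(k,l)} = M_{(i,l),(k,j)}. Then for all real c₁, c₂, c₃: (1) τ(c₁,c₂,c₃)^{T_B} = τ(c₁,−c₂,c₃); and (2) if c₁ ≥ c₂ ≥ |c₃| and λ_{ab} ≥ 0 for all a,b ∈ {0,1} (so that τ is a valid state), then τ(c₁,c₂,c₃)^{T_B} fails to be positive semidefinite if and only if λ_{01} = (1/4)(1 + c₁ + c₂ − c₃) > 1/2. -/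
open Matrix
open scoped Kronecker ComplexOrder

noncomputable section

/-- Pauli matrices. -/
def σ1 : Matrix (Fin 2) (Fin 2) ℂ := !![0, 1; 1, 0]
def σ2 : Matrix (Fin 2) (Fin 2) ℂ := !![0, -Complex.I; Complex.I, 0]
def σ3 : Matrix (Fin 2) (Fin 2) ℂ := !![1, 0; 0, -1]

/-- The 2×2 identity. -/
def I₂ : Matrix (Fin 2) (Fin 2) ℂ := 1

/-- The 4×4 identity `I₂ ⊗ I₂`. -/
def I₄ : Matrix (Fin 2 × Fin 2) (Fin 2 × Fin 2) ℂ := I₂ ⊗ₖ I₂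

/-- The Bell-diagonal family `τ(c₁,c₂,c₃) = (1/4)(I₄ + Σᵢ cᵢ σᵢ⊗σᵢ)`. -/
def τBD (c₁ c₂ c₃ : ℝ) : Matrix (Fin 2 × Fin 2) (Fin 2 × Fin 2) ℂ :=
  (1/4 : ℂ) • (I₄ + (c₁ : ℂ) • (σ1 ⊗ₖ σ1) + (c₂ : ℂ) • (σ2 ⊗ₖ σ2) + (c₃ : ℂ) • (σ3 ⊗ₖ σ3))

/-- `λ_{ab} = (1/4)(1 + (−1)^a c₁ − (−1)^{a+b} c₂ + (−1)^b c₃)`. -/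
def lamBD (c₁ c₂ c₃ : ℝ) (a b : Fin 2) : ℝ :=
  (1/4) * (1 + (-1 : ℝ) ^ (a : ℕ) * c₁ - (-1 : ℝ) ^ ((a : ℕ) + (b : ℕ)) * c₂
    + (-1 : ℝ) ^ (b : ℕ) * c₃)

/-- Partial transpose on subsystem B: `(M^{T_B})_{(i,j),(k,l)} = M_{(i,l),(k,j)}`. -/
def ptB (M : Matrix (Fin 2 × Fin 2) (Fin 2 × Fin 2) ℂ) :
    Matrix (Fin 2 × Fin 2) (Fin 2 × Fin 2) ℂ :=
  fun p q => M (p.1, q.2) (q.1, p.2)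

/-- The Bell vector `|0,b⟩ + (−1)^a |1,1−b⟩`, of squared norm `2`. -/
def bellVec (a b : Fin 2) : Fin 2 × Fin 2 → ℂ :=
  fun p => if p.2 = p.1 + b then (-1 : ℂ) ^ ((a : ℕ) * (p.1 : ℕ)) else 0

theorem τBD_eq_sum_bellVec (c₁ c₂ c₃ : ℝ) :
    τBD c₁ c₂ c₃ = ∑ a : Fin 2, ∑ b : Fin 2,
      (lamBD c₁ c₂ c₃ a b / 2) • vecMulVec (bellVec a b) (star (bellVec a b)) := by
  ext ⟨i, j⟩ ⟨k, l⟩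
  fin_cases i <;> fin_cases j <;> fin_cases k <;> fin_cases l <;>
    simp [τBD, lamBD, bellVec, I₄, I₂, σ1, σ2, σ3, vecMulVec_apply, Fin.sum_univ_two] <;> ring

theorem bellVec_quadraticForm_τBD (c₁ c₂ c₃ : ℝ) (a b : Fin 2) :
    star (bellVec a b) ⬝ᵥ (τBD c₁ c₂ c₃ *ᵥ bellVec a b) =
      ((2 * lamBD c₁ c₂ c₃ a b : ℝ) : ℂ) := by
  fin_cases a <;> fin_cases b <;>
    simp [τBD, lamBD, bellVec, I₄, I₂, σ1, σ2, σ3, dotProduct, mulVec, one_apply,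
      Fintype.sum_prod_type, Fin.sum_univ_two] <;> ring

theorem posSemidef_τBD_iff (c₁ c₂ c₃ : ℝ) :
    (τBD c₁ c₂ c₃).PosSemidef ↔ ∀ a b : Fin 2, 0 ≤ lamBD c₁ c₂ c₃ a b := by
  refine ⟨fun h a b => ?_, fun h => ?_⟩
  · have hab := h.dotProduct_mulVec_nonneg (bellVec a b)
    rw [bellVec_quadraticForm_τBD, Complex.zero_le_real] at hab
    linarith
  · rw [τBD_eq_sum_bellVec]
    exact posSemidef_sum _ fun a _ => posSemidef_sum _ fun b _ =>
      (posSemidef_vecMulVec_self_star _).smul (div_nonneg (h a b) zero_le_two)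

theorem ptB_τBD (c₁ c₂ c₃ : ℝ) : ptB (τBD c₁ c₂ c₃) = τBD c₁ (-c₂) c₃ := by
  ext ⟨i, j⟩ ⟨k, l⟩
  fin_cases i <;> fin_cases j <;> fin_cases k <;> fin_cases l <;>
    simp [ptB, τBD, I₄, I₂, σ1, σ2, σ3]

/-- (1) `τ(c₁,c₂,c₃)^{T_B} = τ(c₁,−c₂,c₃)`; and (2) if `c₁ ≥ c₂ ≥ |c₃|` and all
`λ_{ab} ≥ 0` (so `τ` is a valid state), then `τ(c₁,c₂,c₃)^{T_B}` fails to be positive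
semidefinite if and only if `λ_{01} = (1/4)(1 + c₁ + c₂ − c₃) > 1/2`. -/
theorem stmt_4 (c₁ c₂ c₃ : ℝ) :
    ptB (τBD c₁ c₂ c₃) = τBD c₁ (-c₂) c₃ ∧
    lamBD c₁ c₂ c₃ 0 1 = (1/4) * (1 + c₁ + c₂ - c₃) ∧
    (c₂ ≤ c₁ → |c₃| ≤ c₂ → (∀ a b : Fin 2, 0 ≤ lamBD c₁ c₂ c₃ a b) →
      (¬ (ptB (τBD c₁ c₂ c₃)).PosSemidef ↔ 1/2 < lamBD c₁ c₂ c₃ 0 1)) := by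
  have hlam : lamBD c₁ c₂ c₃ 0 1 = (1/4) * (1 + c₁ + c₂ - c₃) := by
    simp [lamBD]
    ring
  refine ⟨ptB_τBD c₁ c₂ c₃, hlam, fun h₁₂ h₂₃ hpos => ?_⟩
  rw [ptB_τBD, posSemidef_τBD_iff, hlam, not_iff_comm, not_lt]
  obtain ⟨hl, hr⟩ := abs_le.mp h₂₃
  simp only [Fin.forall_fin_two, lamBD, Fin.val_zero, Fin.val_one] at hpos ⊢
  norm_num at hpos ⊢
  obtain ⟨⟨h00, h01⟩, h10, h11⟩ := hpos
  constructor
  · intro h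
    refine ⟨⟨?_, ?_⟩, ?_, ?_⟩ <;> linarith
  · rintro ⟨-, h, -⟩
    linarith

end
end

section
/- Let τ(c₁,c₂,c₃) = (1/4)(I₄ + c₁ σ₁⊗σ₁ + c₂ σ₂⊗σ₂ + c₃ σ₃⊗σ₃) with c₁, c₂, c₃ ∈ [−1,1], and fix i ∈ {1,2,3}. Define the Holevo quantity of the ensemble produced on Bob's side by Alice measuring in the σᵢ eigenbasis as χᵢ = S(ρ_B) − p₊ S(ρ_{B|+}) − p₋ S(ρ_{B|−}), where p_± = Tr[τ(Π_±^{(i)}⊗I₂)], ρ_{B|±} = Tr_A[τ(Π_±^{(i)}⊗I₂)]/p_±, ρ_B = Tr_A τ, Π_±^{(i)} = (1/2)(I₂ ± σᵢ), and S(ρ) = −Σ_μ μ log₂ μ over the eigenvalues μ of ρ. Then χᵢ = 1 − h((1+|cᵢ|)/2), where h is the binary entropy. In particular, the Holevo quantity in the σ₂-basis is 1 − h((1+|c₂|)/2) and in the σ₃-basis is 1 − h((1+|c₃|)/2). -/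
open Matrix
open scoped Kronecker

noncomputable section

/-- The vector of Pauli matrices. -/
def σv : Fin 3 → Matrix (Fin 2) (Fin 2) ℂ := ![σ1, σ2, σ3]

/-- Partial trace over the first qubit: `(Tr_A N)_{j,j'} = Σᵢ N_{(i,j),(i,j')}`. -/
def trA (N : Matrix (Fin 2 × Fin 2) (Fin 2 × Fin 2) ℂ) : Matrix (Fin 2) (Fin 2) ℂ :=
  fun j j' => ∑ i : Fin 2, N (i, j) (i, j')

/-- The binary entropy function. -/
def binEnt (x : ℝ) : ℝ := -(x * Real.logb 2 x) - (1 - x) * Real.logb 2 (1 - x)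

open Classical in
/-- The von Neumann entropy `S(ρ) = −Σ_μ μ log₂ μ` over the eigenvalues of `ρ`
(defined for Hermitian `ρ`; junk value `0` otherwise). -/
def vnEntropy (ρ : Matrix (Fin 2) (Fin 2) ℂ) : ℝ :=
  if h : ρ.IsHermitian then
    -(∑ j, h.eigenvalues j * Real.logb 2 (h.eigenvalues j))
  else 0

/-- The entropy of a qubit state is determined by its determinant. -/
theorem vnEntropy_eq_binEnt {ρ : Matrix (Fin 2) (Fin 2) ℂ} (x : ℝ) (h : ρ.IsHermitian)
    (htr : ρ.trace = 1) (hdet : ρ.det = ((1 - x ^ 2) / 4 : ℝ)) :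
    vnEntropy ρ = binEnt ((1 + x) / 2) := by
  have hsum : h.eigenvalues 0 + h.eigenvalues 1 = 1 := by
    have := h.trace_eq_sum_eigenvalues
    rw [htr, Fin.sum_univ_two] at this
    exact Complex.ofReal_injective (by simpa using this.symm)
  have hprod : h.eigenvalues 0 * h.eigenvalues 1 = (1 - x ^ 2) / 4 := by
    have := h.det_eq_prod_eigenvalues
    rw [hdet, Fin.prod_univ_two] at this
    exact Complex.ofReal_injective (by simpa using this.symm)
  have hb : h.eigenvalues 1 = 1 - h.eigenvalues 0 := by linarith
  simp only [vnEntropy, dif_pos h, Fin.sum_univ_two, binEnt, hb]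
  rw [hb] at hprod
  have hroots : (h.eigenvalues 0 - (1 + x) / 2) * (h.eigenvalues 0 - (1 - x) / 2) = 0 := by
    linarith
  rcases mul_eq_zero.mp hroots with h0 | h0
  · rw [sub_eq_zero.mp h0]
    ring
  · rw [sub_eq_zero.mp h0, show 1 - (1 - x) / 2 = (1 + x) / 2 by ring,
      show 1 - (1 + x) / 2 = (1 - x) / 2 by ring]
    ring

theorem binEnt_half_one_add_abs (x : ℝ) : binEnt ((1 + |x|) / 2) = binEnt ((1 + x) / 2) := by
  rcases abs_choice x with h | h <;> rw [h]
  simp only [binEnt, show 1 - (1 + x) / 2 = (1 + -x) / 2 by ring,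
    show 1 - (1 + -x) / 2 = (1 + x) / 2 by ring]
  ring

theorem binEnt_one_half : binEnt (1 / 2) = 1 := by
  have h : Real.logb 2 (1 / 2) = -1 := by
    rw [one_div, Real.logb_inv, Real.logb_self_eq_one one_lt_two]
  simp only [binEnt, show (1 : ℝ) - 1 / 2 = 1 / 2 by norm_num, h]
  norm_num

theorem vnEntropy_half_one_add_smul_pauli (x : ℝ) (i : Fin 3) :
    vnEntropy ((1 / 2 : ℂ) • (I₂ + (x : ℂ) • σv i)) = binEnt ((1 + x) / 2) := by
  apply vnEntropy_eq_binEnt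
  · ext j k
    fin_cases i <;> fin_cases j <;> fin_cases k <;> simp [σv, σ1, σ2, σ3, I₂] <;> ring
  · fin_cases i <;> simp [σv, σ1, σ2, σ3, I₂, Matrix.trace_fin_two]
  · fin_cases i <;> simp [σv, σ1, σ2, σ3, I₂, Matrix.det_fin_two] <;> ring_nf <;> simp <;> ring

theorem trA_τBD (c₁ c₂ c₃ : ℝ) : trA (τBD c₁ c₂ c₃) = (1 / 2 : ℂ) • I₂ := by
  ext j k
  fin_cases j <;> fin_cases k <;> simp [trA, τBD, I₄, I₂, σ1, σ2, σ3] <;> ring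

/-- The unnormalised state on Bob's side after Alice's Pauli measurement. -/
theorem trA_τBD_mul_measurement (c : Fin 3 → ℝ) (i : Fin 3) (ε : ℝ) :
    trA (τBD (c 0) (c 1) (c 2) * (((1 / 2 : ℂ) • (I₂ + (ε : ℂ) • σv i)) ⊗ₖ I₂)) =
      (1 / 4 : ℂ) • (I₂ + ((ε * c i : ℝ) : ℂ) • σv i) := by
  ext j k
  fin_cases i <;> fin_cases j <;> fin_cases k <;>
    simp [trA, τBD, I₄, I₂, σv, σ1, σ2, σ3, Matrix.mul_apply, Fintype.sum_prod_type] <;>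
    ring_nf

theorem trace_trA (N : Matrix (Fin 2 × Fin 2) (Fin 2 × Fin 2) ℂ) :
    (trA N).trace = N.trace := by
  simp only [Matrix.trace, Matrix.diag, trA, Fintype.sum_prod_type]
  exact Finset.sum_comm

theorem trace_pauli (i : Fin 3) : (σv i).trace = 0 := by
  fin_cases i <;> simp [σv, σ1, σ2, σ3, Matrix.trace_fin_two]

/-- For a Bell-diagonal state with `c₁,c₂,c₃ ∈ [−1,1]` and any `i ∈ {1,2,3}`, the
Holevo quantity `χᵢ = S(ρ_B) − p₊ S(ρ_{B|+}) − p₋ S(ρ_{B|−})` of the ensemble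
produced on Bob's side by Alice measuring in the `σᵢ` eigenbasis equals
`1 − h((1+|cᵢ|)/2)`. -/
theorem stmt_8 (c : Fin 3 → ℝ) (hc : ∀ i, c i ∈ Set.Icc (-1 : ℝ) 1) (i : Fin 3) :
    let τ' := τBD (c 0) (c 1) (c 2)
    let Pmeas : ℝ → Matrix (Fin 2) (Fin 2) ℂ := fun ε =>
      (1/2 : ℂ) • (I₂ + (ε : ℂ) • σv i)
    let p : ℝ → ℝ := fun ε => ((τ' * (Pmeas ε ⊗ₖ I₂)).trace).re
    let ρcond : ℝ → Matrix (Fin 2) (Fin 2) ℂ := fun ε =>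
      ((p ε : ℝ) : ℂ)⁻¹ • trA (τ' * (Pmeas ε ⊗ₖ I₂))
    vnEntropy (trA τ') - p 1 * vnEntropy (ρcond 1) - p (-1) * vnEntropy (ρcond (-1)) =
      1 - binEnt ((1 + |c i|) / 2) := by
  intro τ' Pmeas p ρcond
  have hp (ε : ℝ) : p ε = 1 / 2 := by
    simp only [p, Pmeas, τ']
    rw [← trace_trA, trA_τBD_mul_measurement]
    simp only [Matrix.trace_smul, Matrix.trace_add, trace_pauli, I₂, Matrix.trace_one]
    norm_num
  have hcond (ε : ℝ) : vnEntropy (ρcond ε) = binEnt ((1 + ε * c i) / 2) := by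
    rw [← vnEntropy_half_one_add_smul_pauli _ i]
    simp only [ρcond, hp, Pmeas, τ', trA_τBD_mul_measurement, smul_smul]
    norm_num
  have hB : vnEntropy (trA τ') = 1 := by
    have h := vnEntropy_half_one_add_smul_pauli 0 i
    simp only [Complex.ofReal_zero, zero_smul, add_zero, binEnt_one_half] at h
    rw [trA_τBD, h]
  have hneg := (binEnt_half_one_add_abs (-c i)).symm
  rw [abs_neg] at hneg
  rw [hB, hp, hp, hcond, hcond, one_mul, neg_one_mul, hneg, ← binEnt_half_one_add_abs (c i)]
  ring

end
end

section
/- Let |z₁⟩ = |0⟩ and, for k = 2,3,4, |z_k⟩ = (1/√3)|0⟩ + e^{iφ_k}·√(2/3)|1⟩ with φ₂ = 0, φ₃ = 2π/3, φ₄ = 4π/3 (these are the states |θ*, φ⟩ = cos(θ*/2)|0⟩ + e^{iφ} sin(θ*/2)|1⟩ with cos θ* = −1/3, forming a regular tetrahedron on the Bloch sphere). Let Z_k = |z_k⟩⟨z_k|. Then (1/4) Σ_{k=1}^{4} Z_k ⊗ Z_k = (1/4)(I₄ + (1/3) σ₁⊗σ₁ + (1/3) σ₂⊗σ₂ + (1/3)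 σ₃⊗σ₃) as 4×4 complex matrices; i.e., this separable four-term product-state mixture equals the Bell-diagonal state with c₁ = c₂ = c₃ = 1/3. -/
open Matrix
open scoped Kronecker

noncomputable section

/-- The rank-one projector `|v⟩⟨v|` on a qubit. -/
def proj2 (v : Fin 2 → ℂ) : Matrix (Fin 2) (Fin 2) ℂ := Matrix.vecMulVec v (star v)

/-- The tetrahedral states: `|z₁⟩ = |0⟩` and, for `k = 2,3,4`,
`|z_k⟩ = (1/√3)|0⟩ + e^{iφ_k}·√(2/3)|1⟩` with `φ₂ = 0`, `φ₃ = 2π/3`, `φ₄ = 4π/3`. -/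
def zvec : Fin 4 → (Fin 2 → ℂ)
  | 0 => ![1, 0]
  | 1 => ![((1 / Real.sqrt 3 : ℝ) : ℂ),
      Complex.exp ((0 : ℝ) * Complex.I) * ((Real.sqrt (2/3) : ℝ) : ℂ)]
  | 2 => ![((1 / Real.sqrt 3 : ℝ) : ℂ),
      Complex.exp ((2 * Real.pi / 3 : ℝ) * Complex.I) * ((Real.sqrt (2/3) : ℝ) : ℂ)]
  | 3 => ![((1 / Real.sqrt 3 : ℝ) : ℂ),
      Complex.exp ((4 * Real.pi / 3 : ℝ) * Complex.I) * ((Real.sqrt (2/3) : ℝ) : ℂ)]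

/-- The projector onto `(1/√3)|0⟩ + w·√(2/3)|1⟩` for a unit complex number `w`. -/
theorem proj2_of_unit {w : ℂ} (hw : w * star w = 1) :
    proj2 ![((1 / Real.sqrt 3 : ℝ) : ℂ), w * ((Real.sqrt (2/3) : ℝ) : ℂ)] =
      !![1/3, ((Real.sqrt 2 / 3 : ℝ) : ℂ) * star w;
        ((Real.sqrt 2 / 3 : ℝ) : ℂ) * w, 2/3] := by
  have haa : ((1 / Real.sqrt 3 : ℝ) : ℂ) * ((1 / Real.sqrt 3 : ℝ) : ℂ) = 1/3 := by
    rw [← Complex.ofReal_mul, div_mul_div_comm, Real.mul_self_sqrt (by norm_num)]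
    norm_num
  have hbb : ((Real.sqrt (2/3) : ℝ) : ℂ) * ((Real.sqrt (2/3) : ℝ) : ℂ) = 2/3 := by
    rw [← Complex.ofReal_mul, Real.mul_self_sqrt (by norm_num)]
    norm_num
  have hab : ((1 / Real.sqrt 3 : ℝ) : ℂ) * ((Real.sqrt (2/3) : ℝ) : ℂ) =
      ((Real.sqrt 2 / 3 : ℝ) : ℂ) := by
    rw [← Complex.ofReal_mul, Real.sqrt_div (by norm_num), div_mul_div_comm,
      Real.mul_self_sqrt (by norm_num), one_mul]
  generalize 1 / Real.sqrt 3 = a at *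
  generalize (Real.sqrt (2/3)) = b at *
  simp only [← starRingEnd_apply] at *
  ext i j
  fin_cases i <;> fin_cases j <;>
    simp [proj2, Matrix.vecMulVec_apply, -Complex.ofReal_div]
  · linear_combination haa
  · linear_combination (starRingEnd ℂ w) * hab
  · linear_combination w * hab
  · linear_combination (b * b : ℂ) * hw + hbb

theorem exp_two_pi_div_three :
    Complex.exp ((2 * Real.pi / 3 : ℝ) * Complex.I) =
      -(1/2) + ((Real.sqrt 3 : ℝ) : ℂ) / 2 * Complex.I := by
  have h : 2 * Real.pi / 3 = Real.pi - Real.pi / 3 := by ring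
  rw [Complex.exp_mul_I, ← Complex.ofReal_cos, ← Complex.ofReal_sin, h, Real.cos_pi_sub,
    Real.sin_pi_sub, Real.cos_pi_div_three, Real.sin_pi_div_three]
  push_cast
  ring

theorem exp_four_pi_div_three :
    Complex.exp ((4 * Real.pi / 3 : ℝ) * Complex.I) =
      -(1/2) - ((Real.sqrt 3 : ℝ) : ℂ) / 2 * Complex.I := by
  have h : 4 * Real.pi / 3 = Real.pi / 3 + Real.pi := by ring
  rw [Complex.exp_mul_I, ← Complex.ofReal_cos, ← Complex.ofReal_sin, h, Real.cos_add_pi,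
    Real.sin_add_pi, Real.cos_pi_div_three, Real.sin_pi_div_three]
  push_cast
  ring

/-- The separable four-term product-state mixture `(1/4)Σₖ Z_k ⊗ Z_k` equals the
Bell-diagonal state with `c₁ = c₂ = c₃ = 1/3`. -/
theorem stmt_12 :
    (1/4 : ℂ) • (∑ k : Fin 4, proj2 (zvec k) ⊗ₖ proj2 (zvec k)) =
      (1/4 : ℂ) • (I₄ + ((1/3 : ℝ) : ℂ) • (σ1 ⊗ₖ σ1) + ((1/3 : ℝ) : ℂ) • (σ2 ⊗ₖ σ2)
        + ((1/3 : ℝ) : ℂ) • (σ3 ⊗ₖ σ3)) := by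
  have hs : ((Real.sqrt 3 : ℝ) : ℂ) ^ 2 = 3 := by
    rw [← Complex.ofReal_pow, Real.sq_sqrt (by norm_num)]
    norm_num
  have ht : ((Real.sqrt 2 / 3 : ℝ) : ℂ) ^ 2 = 2 / 9 := by
    rw [← Complex.ofReal_pow, div_pow, Real.sq_sqrt (by norm_num)]
    norm_num
  have h0 : proj2 (zvec 0) = !![1, 0; 0, 0] := by
    ext i j
    fin_cases i <;> fin_cases j <;> simp [proj2, zvec, Matrix.vecMulVec_apply]
  have hunit (x : ℝ) : Complex.exp (x * Complex.I) * star (Complex.exp (x * Complex.I)) = 1 := by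
    rw [← starRingEnd_apply, Complex.mul_conj, Complex.normSq_eq_norm_sq,
      Complex.norm_exp_ofReal_mul_I]
    norm_num
  have h1 := proj2_of_unit (hunit 0)
  have h2 := proj2_of_unit (hunit (2 * Real.pi / 3))
  have h3 := proj2_of_unit (hunit (4 * Real.pi / 3))
  rw [exp_two_pi_div_three] at h2
  rw [exp_four_pi_div_three] at h3
  rw [Fin.sum_univ_four, h0]
  simp only [zvec]
  rw [exp_two_pi_div_three, exp_four_pi_div_three, h1, h2, h3]
  generalize (Real.sqrt 2 / 3) = t at *
  generalize (Real.sqrt 3) = s at *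
  have hI := Complex.I_sq
  congr 1
  ext ⟨i, k⟩ ⟨j, l⟩
  fin_cases i <;> fin_cases k <;> fin_cases j <;> fin_cases l <;>
    simp [Matrix.kroneckerMap_apply, I₄, I₂, σ1, σ2, σ3] <;> grind

end
end

section
/- Let ρ = (1/2)(|00⟩⟨00| + |+1⟩⟨+1|), where |+⟩ = (|0⟩+|1⟩)/√2 and |xy⟩ = |x⟩⊗|y⟩, and let Π_± = (1/2)(I₂ ± (σ₁+σ₃)/√2) be the projectors onto the eigenbasis of the observable (σ₁+σ₃)/√2. Then Tr[ρ(Π_±⊗I₂)] = (1/2)(1 ± 1/√2) and Tr_A[ρ(Π_±⊗I₂)] = (1/2)(1 ± 1/√2) · (I₂/2); i.e., both normalized conditional states of Bob equal the maximally mixed state I₂/2 = Tr_A ρ. Consequently the Holevo quantity of this ensemble, χ = S(Tr_A ρ) − Σ_± p_± S(ρ_{B|±}), vanishes. -/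
open Matrix
open scoped Kronecker

noncomputable section

/-- `|0⟩`, `|1⟩`, `|+⟩ = (|0⟩+|1⟩)/√2`. -/
def ket0 : Fin 2 → ℂ := ![1, 0]
def ket1 : Fin 2 → ℂ := ![0, 1]
def ketPlus : Fin 2 → ℂ := ![((1 / Real.sqrt 2 : ℝ) : ℂ), ((1 / Real.sqrt 2 : ℝ) : ℂ)]

theorem inv_sqrt_two_mul_self_complex :
    ((Real.sqrt 2 : ℝ) : ℂ)⁻¹ * ((Real.sqrt 2 : ℝ) : ℂ)⁻¹ = 1 / 2 := by
  rw [← mul_inv, ← Complex.ofReal_mul, Real.mul_self_sqrt (by norm_num)]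
  norm_num

theorem trace_eq_trace_trA (N : Matrix (Fin 2 × Fin 2) (Fin 2 × Fin 2) ℂ) :
    N.trace = (trA N).trace := by
  simp only [Matrix.trace, Matrix.diag_apply, trA, Fintype.sum_prod_type]
  exact Finset.sum_comm

theorem trA_kronecker (M N : Matrix (Fin 2) (Fin 2) ℂ) : trA (M ⊗ₖ N) = M.trace • N := by
  ext j j'
  simp [trA, Matrix.trace, add_mul]

theorem trA_add (M N : Matrix (Fin 2 × Fin 2) (Fin 2 × Fin 2) ℂ) :
    trA (M + N) = trA M + trA N := by
  ext j j'
  simp [trA, Finset.sum_add_distrib]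

theorem trA_smul (c : ℂ) (M : Matrix (Fin 2 × Fin 2) (Fin 2 × Fin 2) ℂ) :
    trA (c • M) = c • trA M := by
  ext j j'
  simp [trA, mul_add]

theorem proj2_ket0_add_proj2_ket1 : proj2 ket0 + proj2 ket1 = I₂ := by
  ext i j
  fin_cases i <;> fin_cases j <;> simp [proj2, ket0, ket1, I₂, Matrix.vecMulVec]

theorem trace_proj2_ket0 : (proj2 ket0).trace = 1 := by
  simp [proj2, ket0, Matrix.trace, Matrix.vecMulVec]

theorem trace_proj2_ketPlus : (proj2 ketPlus).trace = 1 := by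
  simp [proj2, ketPlus, Matrix.trace, Matrix.vecMulVec, inv_sqrt_two_mul_self_complex]
  norm_num

theorem trace_proj2_ket0_mul_σ1_add_σ3 : (proj2 ket0 * (σ1 + σ3)).trace = 1 := by
  simp [proj2, ket0, σ1, σ3, Matrix.trace, Matrix.vecMulVec, Matrix.mul_apply]

theorem trace_proj2_ketPlus_mul_σ1_add_σ3 : (proj2 ketPlus * (σ1 + σ3)).trace = 1 := by
  simp [proj2, ketPlus, σ1, σ3, Matrix.trace, Matrix.vecMulVec, Matrix.mul_apply,
    inv_sqrt_two_mul_self_complex]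
  norm_num

/-- If `P` has the same expectation `c` in `|0⟩` and `|+⟩`, measuring it leaves Bob's state
maximally mixed. -/
theorem trA_mul_kronecker_one {P : Matrix (Fin 2) (Fin 2) ℂ} {c : ℂ}
    (h0 : (proj2 ket0 * P).trace = c) (hp : (proj2 ketPlus * P).trace = c) :
    trA ((1/2 : ℂ) • (proj2 ket0 ⊗ₖ proj2 ket0 + proj2 ketPlus ⊗ₖ proj2 ket1) * (P ⊗ₖ I₂)) =
      c • ((1/2 : ℂ) • I₂) := by
  rw [Matrix.smul_mul, Matrix.add_mul, ← Matrix.mul_kronecker_mul, ← Matrix.mul_kronecker_mul,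
    trA_smul, trA_add, trA_kronecker, trA_kronecker, h0, hp, ← smul_add]
  rw [I₂, Matrix.mul_one, Matrix.mul_one, proj2_ket0_add_proj2_ket1, I₂, smul_comm]

/-- The expectation of `(I₂ + ε (σ₁ + σ₃)/√2)/2` in a normalized state in which `σ₁ + σ₃` has
expectation one. -/
theorem trace_mul_measurement {A : Matrix (Fin 2) (Fin 2) ℂ} (hA : A.trace = 1)
    (hσ : (A * (σ1 + σ3)).trace = 1) (ε : ℝ) :
    (A * ((1/2 : ℂ) • (I₂ + (ε : ℂ) • (((Real.sqrt 2 : ℝ) : ℂ)⁻¹ • (σ1 + σ3))))).trace =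
      (((1/2) * (1 + ε / Real.sqrt 2) : ℝ) : ℂ) := by
  rw [Matrix.mul_smul, Matrix.mul_add, Matrix.mul_smul, Matrix.mul_smul, I₂, Matrix.mul_one]
  simp only [Matrix.trace_smul, Matrix.trace_add, hA, hσ]
  push_cast
  simp [div_eq_mul_inv]

theorem probability_ne_zero {ε : ℝ} (hε : ε = 1 ∨ ε = -1) :
    (1/2) * (1 + ε / Real.sqrt 2) ≠ 0 := by
  have h1 : 1 < Real.sqrt 2 := Real.lt_sqrt_of_sq_lt (by norm_num)
  have h2 : 1 / Real.sqrt 2 < 1 := (div_lt_one (by linarith)).2 h1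
  have h3 : 0 < 1 / Real.sqrt 2 := by positivity
  rcases hε with rfl | rfl
  · positivity
  · rw [neg_div]
    exact (by linarith : 0 < 1/2 * (1 + -(1 / Real.sqrt 2))).ne'

/-- For `ρ = (1/2)(|00⟩⟨00| + |+1⟩⟨+1|)` and the projectors
`Π_± = (1/2)(I₂ ± (σ₁+σ₃)/√2)` (sign `ε = ±1`):
`Tr[ρ(Π_±⊗I₂)] = (1/2)(1 ± 1/√2)`, `Tr_A[ρ(Π_±⊗I₂)] = (1/2)(1 ± 1/√2)·(I₂/2)`,
`Tr_A ρ = I₂/2`; consequently the Holevo quantity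
`χ = S(Tr_A ρ) − Σ_± p_± S(ρ_{B|±})` of this ensemble vanishes. -/
theorem stmt_14 :
    let ρ := (1/2 : ℂ) • (proj2 ket0 ⊗ₖ proj2 ket0 + proj2 ketPlus ⊗ₖ proj2 ket1)
    let Pmeas : ℝ → Matrix (Fin 2) (Fin 2) ℂ := fun ε =>
      (1/2 : ℂ) • (I₂ + (ε : ℂ) • (((Real.sqrt 2 : ℝ) : ℂ)⁻¹ • (σ1 + σ3)))
    let pr : ℝ → ℝ := fun ε => (1/2) * (1 + ε / Real.sqrt 2)
    trA ρ = (1/2 : ℂ) • I₂ ∧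
    (∀ ε : ℝ, ε = 1 ∨ ε = -1 →
      (ρ * (Pmeas ε ⊗ₖ I₂)).trace = ((pr ε : ℝ) : ℂ) ∧
      trA (ρ * (Pmeas ε ⊗ₖ I₂)) = ((pr ε : ℝ) : ℂ) • ((1/2 : ℂ) • I₂)) ∧
    vnEntropy (trA ρ)
      - pr 1 * vnEntropy (((pr 1 : ℝ) : ℂ)⁻¹ • trA (ρ * (Pmeas 1 ⊗ₖ I₂)))
      - pr (-1) * vnEntropy (((pr (-1) : ℝ) : ℂ)⁻¹ • trA (ρ * (Pmeas (-1) ⊗ₖ I₂))) = 0 := by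
  intro ρ Pmeas pr
  have hρ : trA ρ = (1/2 : ℂ) • I₂ := by
    simp only [ρ, trA_smul, trA_add, trA_kronecker, trace_proj2_ket0, trace_proj2_ketPlus,
      one_smul, proj2_ket0_add_proj2_ket1]
  have hB (ε : ℝ) : trA (ρ * (Pmeas ε ⊗ₖ I₂)) = ((pr ε : ℝ) : ℂ) • ((1/2 : ℂ) • I₂) :=
    trA_mul_kronecker_one
      (trace_mul_measurement trace_proj2_ket0 trace_proj2_ket0_mul_σ1_add_σ3 ε)
      (trace_mul_measurement trace_proj2_ketPlus trace_proj2_ketPlus_mul_σ1_add_σ3 ε)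
  have hcond {ε : ℝ} (hε : ε = 1 ∨ ε = -1) :
      ((pr ε : ℝ) : ℂ)⁻¹ • trA (ρ * (Pmeas ε ⊗ₖ I₂)) = (1/2 : ℂ) • I₂ := by
    rw [hB, inv_smul_smul₀ (Complex.ofReal_ne_zero.2 (probability_ne_zero hε))]
  refine ⟨hρ, fun ε _ => ⟨?_, hB ε⟩, ?_⟩
  · rw [trace_eq_trace_trA, hB]
    simp [I₂]
  · rw [hρ, hcond (Or.inl rfl), hcond (Or.inr rfl)]
    simp only [pr]
    ring

end
end
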